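/- arXiv:1806.10379 — 2 statements merged into one kernel-verified Lean document; each statement's English description precedes it below -/
import Mathlib

section
/- Let n ≥ 3 and let q_1,…,q_n be a polygonal homographic orbit solution of the centered type of the planar n-body system with regular polygon configuration α_i = 2πi/(n−1) for i = 1,…,n−1, in which the n−1 bodies on the circle all have mass equal to a single everywhere-positive function m : ℝ → ℝ and the central body has everywhere-positive mass M : ℝ → ℝ. Then there exists a constant b ∈ ℝ such that for all t: φ'(t) = b/r(t)² and m(t) = (b² − (r''(t) + r(t)·M(t)·f(r(t)²))·r(t)³) / ( r(t)⁴ · Σ_{j=1}^{n−2} (1 − cos(2πj/(n−1))) · f(2r(t)²(1 − cos(2πj/(n−1)))) ). -/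
open Real

/-- The acceleration of a planar curve in polar coordinates. -/
theorem deriv_deriv_polar {r φ : ℝ → ℝ} (hr : ContDiff ℝ 2 r) (hφ : ContDiff ℝ 2 φ)
    (a t : ℝ) :
    deriv (deriv fun t => (r t * Real.cos (φ t + a), r t * Real.sin (φ t + a))) t =
      ((deriv (deriv r) t - r t * deriv φ t ^ 2) * Real.cos (φ t + a) -
          (2 * deriv r t * deriv φ t + r t * deriv (deriv φ) t) * Real.sin (φ t + a),
        (deriv (deriv r) t - r t * deriv φ t ^ 2) * Real.sin (φ t + a) +
          (2 * deriv r t * deriv φ t + r t * deriv (deriv φ) t) * Real.cos (φ t + a)) := by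
  have hr₁ (t) : HasDerivAt r (deriv r t) t :=
    (hr.differentiable (by norm_num)).differentiableAt.hasDerivAt
  have hφ₁ (t) : HasDerivAt φ (deriv φ t) t :=
    (hφ.differentiable (by norm_num)).differentiableAt.hasDerivAt
  have hr₂ : HasDerivAt (deriv r) (deriv (deriv r) t) t :=
    hr.differentiable_deriv_two.differentiableAt.hasDerivAt
  have hφ₂ : HasDerivAt (deriv φ) (deriv (deriv φ) t) t :=
    hφ.differentiable_deriv_two.differentiableAt.hasDerivAt
  have hcos (t) := ((hφ₁ t).add_const a).cos
  have hsin (t) := ((hφ₁ t).add_const a).sin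
  have hvel : (deriv fun t => (r t * Real.cos (φ t + a), r t * Real.sin (φ t + a))) =
      fun t => _ :=
    funext fun t => (((hr₁ t).mul (hcos t)).prodMk ((hr₁ t).mul (hsin t))).deriv
  rw [hvel]
  have hx := (hr₂.mul (hcos t)).add ((hr₁ t).mul ((hsin t).neg.mul hφ₂))
  have hy := (hr₂.mul (hsin t)).add ((hr₁ t).mul ((hcos t).mul hφ₂))
  refine (hx.prodMk hy).deriv.trans ?_
  simp only [Pi.neg_apply, Pi.mul_apply]
  ext <;> simp only <;> ring

/-- An odd function summed against an even weight over the nontrivial vertices of a regular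
polygon gives zero. -/
theorem sum_sin_mul_cos_regular_eq_zero (k : ℕ) (g : ℝ → ℝ) :
    ∑ j ∈ Finset.range (k + 1), Real.sin (2 * π * (j + 1) / (k + 2)) *
      g (Real.cos (2 * π * (j + 1) / (k + 2))) = 0 := by
  set F : ℕ → ℝ := fun j => Real.sin (2 * π * (j + 1) / (k + 2)) *
    g (Real.cos (2 * π * (j + 1) / (k + 2))) with hF
  have hneg : ∀ j ∈ Finset.range (k + 1), F (k + 1 - 1 - j) = -F j := by
    intro j hj
    have hjk : j ≤ k := Nat.lt_succ_iff.mp (Finset.mem_range.mp hj)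
    have hk : (k : ℝ) + 2 ≠ 0 := by positivity
    have hangle : 2 * π * (((k + 1 - 1 - j : ℕ) : ℝ) + 1) / (k + 2) =
        2 * π - 2 * π * (j + 1) / (k + 2) := by
      rw [Nat.add_sub_cancel, Nat.cast_sub hjk]
      field_simp
      ring
    simp only [hF, hangle, Real.sin_two_pi_sub, Real.cos_two_pi_sub, neg_mul]
  have hsum := Finset.sum_range_reflect F (k + 1)
  rw [Finset.sum_congr rfl hneg, Finset.sum_neg_distrib] at hsum
  linarith

/-- The angle at a nontrivial vertex of a regular polygon has cosine less than one. -/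
theorem one_sub_cos_regular_pos {k j : ℕ} (hj : j < k + 1) :
    0 < 1 - Real.cos (2 * π * (j + 1) / (k + 2)) := by
  have hk : (0 : ℝ) < k + 2 := by positivity
  have hlt : 2 * π * (j + 1) / (k + 2) < 2 * π := by
    rw [div_lt_iff₀ hk]
    have : (j : ℝ) < k + 1 := by exact_mod_cast hj
    nlinarith [Real.pi_pos]
  have hpos : 0 < 2 * π * (j + 1) / (k + 2) := by positivity
  refine sub_pos.mpr (lt_of_le_of_ne (Real.cos_le_one _) fun h => ?_)
  exact hpos.ne' ((Real.cos_eq_one_iff_of_lt_of_lt (by linarith) hlt).mp h)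

/-- For a polygonal homographic orbit solution of centered type of the
planar `n`-body problem with regular polygon configuration `α_i = 2πi/(n-1)` for the
`n-1` circling bodies (here bodies on the circle are indexed by `i ∈ {0, …, n-2}` with
phases `α i = 2π(i+1)/(n-1)`; the central body is body `n-1`), with circling masses all
equal to an everywhere-positive function `m` and central mass the everywhere-positive
function `M`, there is a constant `b` such that `φ' = b/r²` and
`m = (b² − (r'' + rMf(r²))r³) / (r⁴ Σ_{j=1}^{n-2} (1 − cos(2πj/(n-1))) f(2r²(1 − cos(2πj/(n-1)))))`. -/
theorem centered_homographic_regular_mass_formula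
    (n : ℕ) (hn : 3 ≤ n)
    -- the kernel `f`: positive on `(0,∞)`, with `x ↦ √x · f x` decreasing on `(0,∞)`
    (f : ℝ → ℝ) (hf_pos : ∀ x > 0, 0 < f x)
    (hf_dec : AntitoneOn (fun x => Real.sqrt x * f x) (Set.Ioi 0))
    -- the common mass function of the circling bodies and the central mass
    (m M : ℝ → ℝ) (hm : ∀ t, 0 < m t) (hM : ∀ t, 0 < M t)
    -- masses in order: bodies `0,…,n-2` have mass `m`, body `n-1` has mass `M`
    (mass : ℕ → ℝ → ℝ) (hmass : ∀ i < n - 1, mass i = m) (hmassn : mass (n - 1) = M)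
    -- the radius, twice continuously differentiable and positive
    (r : ℝ → ℝ) (hr : ContDiff ℝ 2 r) (hr_pos : ∀ t, 0 < r t)
    -- the common rotation angle, twice continuously differentiable
    (φ : ℝ → ℝ) (hφ : ContDiff ℝ 2 φ)
    -- the constant phases: regular polygon configuration `α_i = 2πi/(n-1)`, `i = 1,…,n-1`
    (α : ℕ → ℝ) (hα : ∀ i < n - 1, α i = 2 * π * (i + 1) / (n - 1))
    -- the bodies
    (q : ℕ → ℝ → ℝ × ℝ)
    (hq : ∀ i < n - 1, ∀ t,
      q i t = (r t * Real.cos (φ t + α i), r t * Real.sin (φ t + α i)))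
    (hqn : ∀ t, q (n - 1) t = (0, 0))
    -- the equations of motion
    (hODE : ∀ i < n, ∀ t, deriv (deriv (q i)) t =
      ∑ j ∈ (Finset.range n).erase i,
        (mass j t * f (((q j t).1 - (q i t).1) ^ 2 + ((q j t).2 - (q i t).2) ^ 2)) •
          (q j t - q i t)) :
    -- conclusion
    ∃ b : ℝ, ∀ t,
      deriv φ t = b / r t ^ 2 ∧
      m t = (b ^ 2 - (deriv (deriv r) t + r t * M t * f (r t ^ 2)) * r t ^ 3) /
        (r t ^ 4 * ∑ j ∈ Finset.Icc 1 (n - 2),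
          (1 - Real.cos (2 * π * j / (n - 1))) *
            f (2 * r t ^ 2 * (1 - Real.cos (2 * π * j / (n - 1))))) := by
  obtain ⟨k, rfl⟩ : ∃ k, n = k + 3 := ⟨n - 3, by omega⟩
  have hk : (k : ℝ) + 2 ≠ 0 := by positivity
  have hcast : ((k + 3 : ℕ) : ℝ) - 1 = k + 2 := by push_cast; ring
  simp only [show k + 3 - 1 = k + 2 by omega, hcast] at *
  rw [show k + 3 - 2 = k + 1 by omega]
  set θ : ℕ → ℝ := fun j => 2 * π * (j + 1) / (k + 2) with hθ
  set S : ℝ → ℝ := fun t => ∑ j ∈ Finset.range (k + 1),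
    (1 - Real.cos (θ j)) * f (2 * r t ^ 2 * (1 - Real.cos (θ j))) with hS
  have hlast (t) : q (k + 1) t = (r t * Real.cos (φ t + 0), r t * Real.sin (φ t + 0)) := by
    have h2pi : α (k + 1) = 2 * π := by
      rw [hα _ (by omega)]
      push_cast
      field_simp
      ring
    rw [hq _ (by omega), h2pi, Real.cos_add_two_pi, Real.sin_add_two_pi, add_zero]
  have hforce (t) : deriv (deriv (q (k + 1))) t =
      (∑ j ∈ Finset.range (k + 1), (m t * f (2 * r t ^ 2 * (1 - Real.cos (θ j)))) •
        (r t * ((Real.cos (θ j) - 1) * Real.cos (φ t) - Real.sin (θ j) * Real.sin (φ t)),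
          r t * ((Real.cos (θ j) - 1) * Real.sin (φ t) + Real.sin (θ j) * Real.cos (φ t)))) +
      (M t * f (r t ^ 2)) • (-(r t * Real.cos (φ t)), -(r t * Real.sin (φ t))) := by
    have herase : (Finset.range (k + 3)).erase (k + 1) =
        insert (k + 2) (Finset.range (k + 1)) := by
      ext j
      simp only [Finset.mem_erase, Finset.mem_range, Finset.mem_insert]
      omega
    rw [hODE _ (by omega), herase, Finset.sum_insert (by simp), add_comm]
    congr 1
    · refine Finset.sum_congr rfl fun j hj => ?_
      have hj' : j < k + 2 := by have := Finset.mem_range.mp hj; omega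
      rw [hmass j hj', hq j hj', hlast, hα j hj']
      change (m t * f ((r t * Real.cos (φ t + θ j) - _) ^ 2 +
        (r t * Real.sin (φ t + θ j) - _) ^ 2)) • (r t * Real.cos (φ t + θ j) - _,
          r t * Real.sin (φ t + θ j) - _) = _
      simp only [Real.cos_add, Real.sin_add, Real.cos_zero, Real.sin_zero]
      congr 3
      · linear_combination r t ^ 2 * (1 + Real.cos (θ j) ^ 2 + Real.sin (θ j) ^ 2 -
          2 * Real.cos (θ j)) * Real.sin_sq_add_cos_sq (φ t) +
            r t ^ 2 * Real.sin_sq_add_cos_sq (θ j)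
      · ring
      · ring
    · rw [hmassn, hqn, hlast]
      simp only [add_zero, Prod.mk_sub_mk, zero_sub]
      congr 3
      linear_combination r t ^ 2 * Real.sin_sq_add_cos_sq (φ t)
  have htan (t) : ∑ j ∈ Finset.range (k + 1),
      Real.sin (θ j) * f (2 * r t ^ 2 * (1 - Real.cos (θ j))) = 0 :=
    sum_sin_mul_cos_regular_eq_zero k fun c => f (2 * r t ^ 2 * (1 - c))
  have hacc (t) :
      deriv (deriv r) t - r t * deriv φ t ^ 2 =
          -(m t * r t * S t) - r t * (M t * f (r t ^ 2)) ∧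
        2 * deriv r t * deriv φ t + r t * deriv (deriv φ) t = 0 := by
    have h := hforce t
    rw [funext hlast, deriv_deriv_polar hr hφ] at h
    simp only [add_zero] at h
    have hx := congrArg Prod.fst h
    have hy := congrArg Prod.snd h
    simp only [Prod.fst_add, Prod.snd_add, Prod.fst_sum, Prod.snd_sum, Prod.smul_fst,
      Prod.smul_snd, smul_eq_mul] at hx hy
    have hsumx : ∑ j ∈ Finset.range (k + 1), m t * f (2 * r t ^ 2 * (1 - Real.cos (θ j))) *
        (r t * ((Real.cos (θ j) - 1) * Real.cos (φ t) - Real.sin (θ j) * Real.sin (φ t))) =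
        -(m t * r t * S t) * Real.cos (φ t) := by
      have := htan t
      rw [← sub_zero (-(m t * r t * S t) * Real.cos (φ t)),
        ← mul_zero (m t * r t * Real.sin (φ t)), ← this, hS, Finset.mul_sum, Finset.mul_sum,
        ← Finset.sum_neg_distrib, Finset.sum_mul, ← Finset.sum_sub_distrib]
      exact Finset.sum_congr rfl fun j _ => by ring
    have hsumy : ∑ j ∈ Finset.range (k + 1), m t * f (2 * r t ^ 2 * (1 - Real.cos (θ j))) *
        (r t * ((Real.cos (θ j) - 1) * Real.sin (φ t) + Real.sin (θ j) * Real.cos (φ t))) =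
        -(m t * r t * S t) * Real.sin (φ t) := by
      have := htan t
      rw [← add_zero (-(m t * r t * S t) * Real.sin (φ t)),
        ← mul_zero (m t * r t * Real.cos (φ t)), ← this, hS, Finset.mul_sum, Finset.mul_sum,
        ← Finset.sum_neg_distrib, Finset.sum_mul, ← Finset.sum_add_distrib]
      exact Finset.sum_congr rfl fun j _ => by ring
    rw [hsumx] at hx
    rw [hsumy] at hy
    generalize deriv (deriv r) t - r t * deriv φ t ^ 2 = A at hx hy ⊢
    generalize 2 * deriv r t * deriv φ t + r t * deriv (deriv φ) t = B at hx hy ⊢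
    have hone := Real.sin_sq_add_cos_sq (φ t)
    constructor
    · linear_combination Real.cos (φ t) * hx + Real.sin (φ t) * hy -
        (A + m t * r t * S t + r t * (M t * f (r t ^ 2))) * hone
    · linear_combination Real.cos (φ t) * hy - Real.sin (φ t) * hx - B * hone
  have hmom (t) : HasDerivAt (fun t => r t ^ 2 * deriv φ t) 0 t := by
    have hr₁ : HasDerivAt r (deriv r t) t :=
      (hr.differentiable (by norm_num)).differentiableAt.hasDerivAt
    have hφ₂ : HasDerivAt (deriv φ) (deriv (deriv φ) t) t :=
      hφ.differentiable_deriv_two.differentiableAt.hasDerivAt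
    refine ((hr₁.pow 2).mul hφ₂).congr_deriv ?_
    simp only [Pi.pow_apply]
    linear_combination r t * (hacc t).2
  have hconst (t) : r t ^ 2 * deriv φ t = r 0 ^ 2 * deriv φ 0 :=
    is_const_of_deriv_eq_zero (fun t => (hmom t).differentiableAt) (fun t => (hmom t).deriv) t 0
  refine ⟨r 0 ^ 2 * deriv φ 0, fun t => ?_⟩
  have hrt := hr_pos t
  have hSpos : 0 < S t := Finset.sum_pos (fun j hj => by
    have hc := one_sub_cos_regular_pos (Finset.mem_range.mp hj)
    exact mul_pos hc (hf_pos _ (by positivity))) (by simp)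
  have hSIcc : ∑ j ∈ Finset.Icc 1 (k + 1), (1 - Real.cos (2 * π * j / (k + 2))) *
      f (2 * r t ^ 2 * (1 - Real.cos (2 * π * j / (k + 2)))) = S t := by
    rw [← Finset.Ico_add_one_right_eq_Icc, Finset.sum_Ico_eq_sum_range]
    refine Finset.sum_congr rfl fun j _ => ?_
    simp only [hθ]
    push_cast
    rw [add_comm (1 : ℝ)]
  rw [hSIcc, ← hconst t]
  constructor
  · field_simp
  · rw [eq_div_iff (by positivity)]
    linear_combination (r t ^ 3) * (hacc t).1
end

section
/- Let q_1,…,q_n be a circular solution of the planar n-body system in which all masses are equal, m_1 = … = m_n = m for a single everywhere-positive function m : ℝ → ℝ, and suppose that at a time t the ordered angles satisfy θ_{j+1}(t) − θ_j(t) ≥ θ_2(t) − θ_1(t) for all j ∈ {1,…,n} (with θ_{n+1} := θ_1 + 2π). Then at that time 2r'(t)·θ_1'(t) + r(t)·θ_1''(t) ≥ 2r'(t)·θ_2'(t) + r(t)·θ_2''(t). -/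
open Real

/-- The tangential force exerted by a unit mass at angular distance `x` on a circle of
radius `ρ`, for the kernel `f`. -/
noncomputable def tangentialForce (f : ℝ → ℝ) (ρ x : ℝ) : ℝ :=
  ρ * sin x * f (2 * ρ ^ 2 * (1 - cos x))

theorem tangentialForce_zero (f : ℝ → ℝ) (ρ : ℝ) : tangentialForce f ρ 0 = 0 := by
  simp [tangentialForce]

theorem tangentialForce_add_two_pi (f : ℝ → ℝ) (ρ x : ℝ) :
    tangentialForce f ρ (x + 2 * π) = tangentialForce f ρ x := by
  simp [tangentialForce]

theorem one_sub_cos_eq (x : ℝ) : 1 - cos x = 2 * sin (x / 2) ^ 2 := by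
  rw [sin_sq_eq_half_sub, mul_div_cancel₀ _ (two_ne_zero' ℝ)]
  ring

theorem one_sub_cos_pos {x : ℝ} (hx : x ∈ Set.Ioo 0 (2 * π)) : 0 < 1 - cos x := by
  have h : 0 < sin (x / 2) := sin_pos_of_pos_of_lt_pi (by linarith [hx.1]) (by linarith [hx.2])
  rw [one_sub_cos_eq]
  positivity

theorem tangentialForce_eq_cos_mul (f : ℝ → ℝ) {ρ x : ℝ} (hρ : 0 < ρ)
    (hx : x ∈ Set.Ioo 0 (2 * π)) :
    tangentialForce f ρ x =
      cos (x / 2) * (√(2 * ρ ^ 2 * (1 - cos x)) * f (2 * ρ ^ 2 * (1 - cos x))) := by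
  have h : 0 < sin (x / 2) := sin_pos_of_pos_of_lt_pi (by linarith [hx.1]) (by linarith [hx.2])
  have hs : √(2 * ρ ^ 2 * (1 - cos x)) = 2 * ρ * sin (x / 2) := by
    rw [one_sub_cos_eq, show 2 * ρ ^ 2 * (2 * sin (x / 2) ^ 2) = (2 * ρ * sin (x / 2)) ^ 2 by ring]
    exact sqrt_sq (by positivity)
  have h2 : sin x = 2 * sin (x / 2) * cos (x / 2) := by
    rw [← sin_two_mul]
    ring_nf
  rw [hs, tangentialForce, h2]
  ring

theorem tangentialForce_antitoneOn {f : ℝ → ℝ} (hf_pos : ∀ x > 0, 0 < f x)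
    (hf_dec : AntitoneOn (fun x => √x * f x) (Set.Ioi 0)) {ρ : ℝ} (hρ : 0 < ρ) :
    AntitoneOn (tangentialForce f ρ) (Set.Ioo 0 (2 * π)) := by
  intro x hx y hy hxy
  have hpos : ∀ z ∈ Set.Ioo 0 (2 * π), 0 < 2 * ρ ^ 2 * (1 - cos z) := fun z hz => by
    have := one_sub_cos_pos hz
    positivity
  have hnonneg : ∀ z ∈ Set.Ioo 0 (2 * π),
      0 ≤ √(2 * ρ ^ 2 * (1 - cos z)) * f (2 * ρ ^ 2 * (1 - cos z)) := fun z hz =>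
    mul_nonneg (sqrt_nonneg _) (hf_pos _ (hpos z hz)).le
  have hdec : ∀ u ∈ Set.Ioo 0 (2 * π), ∀ v ∈ Set.Ioo 0 (2 * π), cos v ≤ cos u →
      √(2 * ρ ^ 2 * (1 - cos v)) * f (2 * ρ ^ 2 * (1 - cos v)) ≤
        √(2 * ρ ^ 2 * (1 - cos u)) * f (2 * ρ ^ 2 * (1 - cos u)) := fun u hu v hv h =>
    hf_dec (hpos u hu) (hpos v hv) (by gcongr)
  have hcos : cos (y / 2) ≤ cos (x / 2) :=
    cos_le_cos_of_nonneg_of_le_pi (by linarith [hx.1]) (by linarith [hy.2]) (by linarith)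
  rw [tangentialForce_eq_cos_mul f hρ hx, tangentialForce_eq_cos_mul f hρ hy]
  have hcos_nonneg : ∀ z ∈ Set.Ioo 0 (2 * π), z ≤ π → 0 ≤ cos (z / 2) := fun z hz h =>
    cos_nonneg_of_neg_pi_div_two_le_of_le (by linarith [hz.1, pi_pos]) (by linarith)
  have hcos_nonpos : ∀ z ∈ Set.Ioo 0 (2 * π), π ≤ z → cos (z / 2) ≤ 0 := fun z hz h =>
    cos_nonpos_of_pi_div_two_le_of_le (by linarith) (by linarith [hz.2, pi_pos])
  rcases le_total y π with hyπ | hyπ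
  · exact mul_le_mul hcos
      (hdec x hx y hy (cos_le_cos_of_nonneg_of_le_pi hx.1.le hyπ hxy))
      (hnonneg y hy) (hcos_nonneg x hx (hxy.trans hyπ))
  rcases le_total x π with hxπ | hxπ
  · exact (mul_nonpos_of_nonpos_of_nonneg (hcos_nonpos y hy hyπ) (hnonneg y hy)).trans
      (mul_nonneg (hcos_nonneg x hx hxπ) (hnonneg x hx))
  · have hxy' : cos x ≤ cos y := by
      rw [← cos_two_pi_sub x, ← cos_two_pi_sub y]
      exact cos_le_cos_of_nonneg_of_le_pi (by linarith [hy.2]) (by linarith) (by linarith)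
    have h := hdec y hy x hx hxy'
    have hx0 := hnonneg x hx
    nlinarith [hcos_nonpos x hx hxπ, hcos_nonpos y hy hyπ]

/-- The tangential component of the acceleration in polar coordinates. -/
theorem polar_tangential_acceleration {r φ : ℝ → ℝ} (hr : ContDiff ℝ 2 r)
    (hφ : ContDiff ℝ 2 φ) {q : ℝ → ℝ × ℝ}
    (hq : ∀ t, q t = (r t * cos (φ t), r t * sin (φ t))) (t : ℝ) :
    cos (φ t) * (deriv (deriv q) t).2 - sin (φ t) * (deriv (deriv q) t).1 =
      2 * deriv r t * deriv φ t + r t * deriv (deriv φ) t := by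
  have hasDerivAt_of : ∀ {g : ℝ → ℝ}, ContDiff ℝ 2 g → ∀ s,
      HasDerivAt g (deriv g s) s ∧ HasDerivAt (deriv g) (deriv (deriv g) s) s := fun {g} hg s =>
    ⟨(hg.differentiable (by norm_num) s).hasDerivAt,
      ((ContDiff.differentiable_deriv_two hg) s).hasDerivAt⟩
  have hq' : deriv q = fun s =>
      (deriv r s * cos (φ s) + r s * (-sin (φ s) * deriv φ s),
        deriv r s * sin (φ s) + r s * (cos (φ s) * deriv φ s)) := by
    rw [funext hq]
    funext s
    have h1 := (hasDerivAt_of hr s).1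
    have h2 := (hasDerivAt_of hφ s).1
    exact ((h1.mul h2.cos).prodMk (h1.mul h2.sin)).deriv
  obtain ⟨h1, h1'⟩ := hasDerivAt_of hr t
  obtain ⟨h2, h2'⟩ := hasDerivAt_of hφ t
  have hd := (((h1'.mul h2.cos).add (h1.mul (h2.sin.neg.mul h2'))).prodMk
    ((h1'.mul h2.sin).add (h1.mul (h2.cos.mul h2')))).deriv
  rw [show deriv (deriv q) t = _ from (congrArg (deriv · t) hq').trans hd]
  simp only [Pi.mul_apply, Pi.neg_apply]
  linear_combination (2 * deriv r t * deriv φ t + r t * deriv (deriv φ) t) *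
    sin_sq_add_cos_sq (φ t)

theorem sum_tangentialForce_shift_le {f : ℝ → ℝ} (hf_pos : ∀ x > 0, 0 < f x)
    (hf_dec : AntitoneOn (fun x => √x * f x) (Set.Ioi 0)) {ρ : ℝ} (hρ : 0 < ρ)
    {n : ℕ} (hn : 2 ≤ n) {α : ℕ → ℝ} (hα : ∀ i j, i < j → j ≤ n → α i < α j)
    (hαn : α n = α 0 + 2 * π) (hgap : ∀ j < n, α 1 - α 0 ≤ α (j + 1) - α j) :
    ∑ j ∈ Finset.range n, tangentialForce f ρ (α j - α 1) ≤
      ∑ j ∈ Finset.range n, tangentialForce f ρ (α j - α 0) := by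
  have hper : tangentialForce f ρ (α n - α 1) = tangentialForce f ρ (α 0 - α 1) := by
    rw [hαn, ← tangentialForce_add_two_pi f ρ (α 0 - α 1)]
    ring_nf
  have hshift : ∑ j ∈ Finset.range n, tangentialForce f ρ (α j - α 1) =
      ∑ j ∈ Finset.range n, tangentialForce f ρ (α (j + 1) - α 1) := by
    have h := Finset.sum_range_succ (fun j => tangentialForce f ρ (α j - α 1)) n
    rw [Finset.sum_range_succ', hper] at h
    linarith
  rw [hshift]
  refine Finset.sum_le_sum fun j hj => ?_
  have hjn := Finset.mem_range.1 hj
  rcases Nat.eq_zero_or_pos j with rfl | hj0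
  · simp
  · have h01 := hα 0 1 one_pos (by lia)
    have hj := hα j n hjn le_rfl
    have h0j := hα 0 j hj0 hjn.le
    have h1j := hα 1 (j + 1) (by lia) hjn
    have hjn' : α (j + 1) ≤ α n := by
      rcases (Nat.succ_le_of_lt hjn).eq_or_lt with h | h
      · exact (congrArg α h).le
      · exact (hα (j + 1) n h le_rfl).le
    exact tangentialForce_antitoneOn hf_pos hf_dec hρ ⟨by linarith, by linarith⟩
      ⟨by linarith, by linarith⟩ (by linarith [hgap j hjn])

/-- For a circular solution of the planar `n`-body problem with all masses
equal to a single everywhere-positive function `m`: if at a time `t` all angular gaps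
are at least the first gap, i.e. `θ_{j+1}(t) − θ_j(t) ≥ θ₁(t) − θ₀(t)` for all `j`
(with `θ_n := θ₀ + 2π`; bodies are indexed by `i ∈ {0, …, n-1}`), then
`2r'(t)θ₀'(t) + r(t)θ₀''(t) ≥ 2r'(t)θ₁'(t) + r(t)θ₁''(t)`. -/
theorem circular_first_gap_inequality
    (n : ℕ) (hn : 2 ≤ n)
    -- the kernel `f`: positive on `(0,∞)`, with `x ↦ √x · f x` decreasing on `(0,∞)`
    (f : ℝ → ℝ) (hf_pos : ∀ x > 0, 0 < f x)
    (hf_dec : AntitoneOn (fun x => Real.sqrt x * f x) (Set.Ioi 0))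
    -- the common mass function, everywhere positive
    (m : ℝ → ℝ) (hm : ∀ t, 0 < m t)
    -- the radius, twice continuously differentiable and positive
    (r : ℝ → ℝ) (hr : ContDiff ℝ 2 r) (hr_pos : ∀ t, 0 < r t)
    -- the angles, twice continuously differentiable and ordered
    (θ : ℕ → ℝ → ℝ) (hθ : ∀ i < n, ContDiff ℝ 2 (θ i))
    (hord : ∀ t, ∀ i j, i < j → j < n → θ i t < θ j t)
    (hord2 : ∀ t, ∀ i < n, θ i t < θ 0 t + 2 * π)
    -- the bodies, lying on a circle of radius `r`
    (q : ℕ → ℝ → ℝ × ℝ)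
    (hq : ∀ i < n, ∀ t, q i t = (r t * Real.cos (θ i t), r t * Real.sin (θ i t)))
    -- the equations of motion
    (hODE : ∀ i < n, ∀ t, deriv (deriv (q i)) t =
      ∑ j ∈ (Finset.range n).erase i,
        (m t * f (((q j t).1 - (q i t).1) ^ 2 + ((q j t).2 - (q i t).2) ^ 2)) •
          (q j t - q i t))
    -- the time at which the gap condition holds
    (t : ℝ)
    (hgap : ∀ j < n,
      (if j + 1 = n then θ 0 t + 2 * π else θ (j + 1) t) - θ j t ≥ θ 1 t - θ 0 t) :
    2 * deriv r t * deriv (θ 0) t + r t * deriv (deriv (θ 0)) t ≥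
      2 * deriv r t * deriv (θ 1) t + r t * deriv (deriv (θ 1)) t := by
  let α : ℕ → ℝ := fun j => if j = n then θ 0 t + 2 * π else θ j t
  have hα_lt : ∀ j < n, α j = θ j t := fun j hj => if_neg hj.ne
  have hα_n : α n = θ 0 t + 2 * π := if_pos rfl
  have key : ∀ i < n, 2 * deriv r t * deriv (θ i) t + r t * deriv (deriv (θ i)) t =
      m t * ∑ j ∈ Finset.range n, tangentialForce f (r t) (α j - α i) := by
    intro i hi
    rw [← polar_tangential_acceleration hr (hθ i hi) (hq i hi) t, hODE i hi t,
      ← Finset.add_sum_erase _ _ (Finset.mem_range.2 hi), sub_self, tangentialForce_zero,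
      zero_add, Prod.fst_sum, Prod.snd_sum, Finset.mul_sum, Finset.mul_sum, Finset.mul_sum,
      ← Finset.sum_sub_distrib]
    refine Finset.sum_congr rfl fun j hj => ?_
    have hj := Finset.mem_range.1 (Finset.mem_of_mem_erase hj)
    have hdist : (r t * cos (θ j t) - r t * cos (θ i t)) ^ 2 +
        (r t * sin (θ j t) - r t * sin (θ i t)) ^ 2 =
          2 * r t ^ 2 * (1 - cos (θ j t - θ i t)) := by
      rw [cos_sub]
      linear_combination r t ^ 2 * sin_sq_add_cos_sq (θ j t) +
        r t ^ 2 * sin_sq_add_cos_sq (θ i t)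
    rw [hα_lt j hj, hα_lt i hi, hq i hi, hq j hj]
    simp only [Prod.smul_fst, Prod.smul_snd, Prod.fst_sub, Prod.snd_sub, smul_eq_mul]
    rw [hdist, tangentialForce, sin_sub]
    ring
  rw [ge_iff_le, key 0 (by lia), key 1 (by lia)]
  refine mul_le_mul_of_nonneg_left (sum_tangentialForce_shift_le hf_pos hf_dec (hr_pos t) hn
    (fun i j hij hj => ?_) ?_ fun j hj => ?_) (hm t).le
  · rw [hα_lt i (by lia)]
    rcases hj.eq_or_lt with rfl | hj
    · exact hα_n ▸ hord2 t i hij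
    · exact hα_lt j hj ▸ hord t i j hij hj
  · rw [hα_n, hα_lt 0 (by lia)]
  · have h := hgap j hj
    rw [hα_lt 0 (by lia), hα_lt 1 (by lia), hα_lt j hj]
    simp only [α]
    by_cases hjn : j + 1 = n
    · rw [if_pos hjn] at h ⊢
      exact h
    · rw [if_neg hjn] at h ⊢
      exact h
end
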